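/- arXiv:2409.05706 — 2 statements merged into one kernel-verified Lean document; each statement's English description precedes it below -/
import Mathlib

section
/- Let $\alpha,\beta\ge 0$, $m,n\in\mathbb{N}_0$, $\mathbf{p}\in[1,\infty]^2$. There exists $C=C(d,\alpha,\beta,m,n,\mathbf{p})$ such that for all $t\in(0,1]$, $\big\| |x|^\alpha |v|^\beta |\nabla_x^m\nabla_v^n g_t(x,v)| \big\|_{\mathbf{p}} \le C\, t^{\frac{3(\alpha-m)}{2} + \frac{\beta-n}{2} - \mathbf{a}\cdot\frac{d}{2}(1-\frac{1}{\mathbf{p}})}$, where $\mathbf{a}=(3,1)$. -/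
open MeasureTheory Real ENNReal

noncomputable section

/-- The kinetic Gaussian kernel `g_t` on `ℝ^d × ℝ^d`. -/
def gker (d : ℕ) (t : ℝ)
    (z : EuclideanSpace ℝ (Fin d) × EuclideanSpace ℝ (Fin d)) : ℝ :=
  (Real.pi * t ^ 4 / 3) ^ (-(d : ℝ) / 2) *
    Real.exp (-(3 * ‖z.1‖ ^ 2 + ‖(3 : ℝ) • z.1 - (2 * t) • z.2‖ ^ 2) / (2 * t ^ 3))

/-- The anisotropic mixed norm `‖f‖_{(p_x,p_v)}`. -/
def mixedNorm {d : ℕ} (px pv : ℝ≥0∞)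
    (f : EuclideanSpace ℝ (Fin d) × EuclideanSpace ℝ (Fin d) → ℝ) : ℝ≥0∞ :=
  eLpNorm (fun v => (eLpNorm (fun x => f (x, v)) px volume).toReal) pv volume


theorem norm_iteratedFDeriv_iteratedFDeriv {W G : Type*} [NormedAddCommGroup W]
    [NormedSpace ℝ W] [NormedAddCommGroup G] [NormedSpace ℝ G] (f : W → G) (n m : ℕ) (z : W) :
    ‖iteratedFDeriv ℝ n (iteratedFDeriv ℝ m f) z‖ = ‖iteratedFDeriv ℝ (n + m) f z‖ := by
  induction m generalizing n with
  | zero =>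
    rw [iteratedFDeriv_zero_eq_comp, LinearIsometryEquiv.norm_iteratedFDeriv_comp_left, add_zero]
  | succ m ih =>
    have h := LinearIsometryEquiv.norm_iteratedFDeriv_comp_left (𝕜 := ℝ) (E := W)
      (F := W →L[ℝ] W [×m]→L[ℝ] G) (G := W [×(m + 1)]→L[ℝ] G)
      (continuousMultilinearCurryLeftEquiv ℝ (fun _ : Fin (m + 1) => W) G).symm
      (fderiv ℝ (iteratedFDeriv ℝ m f)) z n
    rw [← iteratedFDeriv_succ_eq_comp_left] at h
    rw [h, norm_iteratedFDeriv_fderiv, ih, Nat.add_right_comm, add_assoc]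

/-- Iterated partial derivatives along two linear maps are controlled by the full derivative. -/
theorem norm_iteratedFDeriv_iteratedFDeriv_comp_add_le {E F W : Type*}
    [NormedAddCommGroup E] [NormedSpace ℝ E] [NormedAddCommGroup F] [NormedSpace ℝ F]
    [NormedAddCommGroup W] [NormedSpace ℝ W] {f : W → ℝ} (hf : ContDiff ℝ ⊤ f)
    (A : E →L[ℝ] W) (B : F →L[ℝ] W) (n m : ℕ) (x : E) (v : F) :
    ‖iteratedFDeriv ℝ n (fun v' => iteratedFDeriv ℝ m (fun x' => f (A x' + B v')) x) v‖
      ≤ ‖A‖ ^ m * ‖B‖ ^ n * ‖iteratedFDeriv ℝ (n + m) f (A x + B v)‖ := by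
  have partial_eq (v' : F) : iteratedFDeriv ℝ m (fun x' => f (A x' + B v')) x =
      ContinuousMultilinearMap.compContinuousLinearMapL (fun _ => A)
        (iteratedFDeriv ℝ m f (A x + B v')) := by
    have hs : ContDiff ℝ ⊤ (fun w => f (w + B v')) := by fun_prop
    rw [← iteratedFDeriv_comp_add_right]
    exact A.iteratedFDeriv_comp_right hs x (i := m) le_top
  have hm : ContDiff ℝ ⊤ (iteratedFDeriv ℝ m f) := hf.iteratedFDeriv_right le_top
  have hs : ContDiff ℝ ⊤ (fun w => iteratedFDeriv ℝ m f (A x + w)) := by fun_prop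
  have hc := B.iteratedFDeriv_comp_right hs v (i := n) le_top
  have hL := ContinuousMultilinearMap.norm_compContinuousLinearMapL_le (𝕜 := ℝ) ℝ
    (fun _ : Fin m => A)
  simp only [Finset.prod_const, Finset.card_univ, Fintype.card_fin] at hL
  simp_rw [partial_eq]
  refine (ContinuousLinearMap.norm_iteratedFDeriv_comp_left _
    (f := fun v' => iteratedFDeriv ℝ m f (A x + B v'))
    (hs.comp B.contDiff).contDiffAt (N := ⊤) (n := n) le_top).trans ?_
  rw [mul_assoc]
  gcongr
  change ‖iteratedFDeriv ℝ n ((fun w => iteratedFDeriv ℝ m f (A x + w)) ∘ B) v‖ ≤ _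
  rw [hc, iteratedFDeriv_comp_add_left]
  refine (ContinuousMultilinearMap.norm_compContinuousLinearMap_le _ _).trans ?_
  simp [norm_iteratedFDeriv_iteratedFDeriv, mul_comm]

theorem exists_norm_iteratedFDeriv_bilinear_le {W : Type*} [NormedAddCommGroup W]
    [NormedSpace ℝ W] (B : W →L[ℝ] W →L[ℝ] ℝ) :
    ∃ K : ℝ, 0 ≤ K ∧ ∀ (z : W) (i : ℕ), 1 ≤ i →
      ‖iteratedFDeriv ℝ i (fun z => -(B z z)) z‖ ≤ (K * (1 + ‖z‖)) ^ i := by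
  set L : W →L[ℝ] W →L[ℝ] ℝ := -(B + B.flip) with hL
  have hd : fderiv ℝ (fun z => -(B z z)) = L := by
    ext1 z
    have h := (B.hasFDerivAt_of_bilinear (hasFDerivAt_id z) (hasFDerivAt_id z)).fun_neg
    refine h.fderiv.trans ?_
    ext w
    simp [hL]
  refine ⟨1 + ‖L‖, by positivity, fun z i hi => ?_⟩
  have hLz : ‖L‖ ≤ (1 + ‖L‖) * (1 + ‖z‖) := by nlinarith [norm_nonneg L, norm_nonneg z]
  have h1 : 1 ≤ (1 + ‖L‖) * (1 + ‖z‖) := by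
    nlinarith [norm_nonneg L, norm_nonneg z, mul_nonneg (norm_nonneg L) (norm_nonneg z)]
  match i, hi with
  | 1, _ =>
    rw [← norm_iteratedFDeriv_fderiv, norm_iteratedFDeriv_zero, hd, pow_one]
    refine (L.le_opNorm z).trans ?_
    nlinarith [norm_nonneg L, norm_nonneg z]
  | 2, _ =>
    rw [← norm_iteratedFDeriv_fderiv, ← norm_iteratedFDeriv_fderiv, norm_iteratedFDeriv_zero, hd,
      L.fderiv]
    exact hLz.trans (le_self_pow₀ h1 two_ne_zero)
  | i + 3, _ =>
    rw [← norm_iteratedFDeriv_fderiv, ← norm_iteratedFDeriv_fderiv, hd]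
    have : fderiv ℝ L = fun _ => L := by ext1 z; exact L.fderiv
    rw [this, iteratedFDeriv_succ_const]
    simpa using by positivity

theorem exists_norm_iteratedFDeriv_exp_neg_bilinear_le {W : Type*} [NormedAddCommGroup W]
    [NormedSpace ℝ W] (B : W →L[ℝ] W →L[ℝ] ℝ) (n : ℕ) :
    ∃ K : ℝ, 0 ≤ K ∧ ∀ z : W,
      ‖iteratedFDeriv ℝ n (fun z => Real.exp (-(B z z))) z‖
        ≤ K * (1 + ‖z‖) ^ n * Real.exp (-(B z z)) := by
  obtain ⟨K, hK, h⟩ := exists_norm_iteratedFDeriv_bilinear_le B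
  refine ⟨n.factorial * K ^ n, by positivity, fun z => ?_⟩
  have hq : ContDiff ℝ ⊤ (fun z => -(B z z)) := by fun_prop
  have := norm_iteratedFDeriv_comp_le (𝕜 := ℝ) (n := n) (N := ⊤) Real.contDiff_exp hq le_top z
    (C := Real.exp (-(B z z))) (D := K * (1 + ‖z‖)) (fun i _ => by
      rw [norm_iteratedFDeriv_eq_norm_iteratedDeriv, iteratedDeriv_eq_iterate, Real.iter_deriv_exp,
        Real.norm_of_nonneg (Real.exp_nonneg _)]) (fun i hi _ => h z i hi)
  refine this.trans (le_of_eq ?_)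
  rw [mul_pow]; ring

theorem eLpNorm_comp_const_smul_real {E : Type*} [NormedAddCommGroup E] [NormedSpace ℝ E]
    [FiniteDimensional ℝ E] [MeasurableSpace E] [BorelSpace E] (μ : Measure E) [μ.IsAddHaarMeasure]
    {φ : E → ℝ} (hφ : Continuous φ) (p : ℝ≥0∞) {c : ℝ} (hc : 0 < c) :
    eLpNorm (fun x => φ (c • x)) p μ =
      ENNReal.ofReal (c ^ (-(Module.finrank ℝ E * (p⁻¹).toReal))) * eLpNorm φ p μ := by
  have hmap := Measure.map_addHaar_smul μ hc.ne'
  have hpos : 0 < |(c ^ Module.finrank ℝ E)⁻¹| := by positivity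
  have h := eLpNorm_map_measure (p := p) (μ := μ) (f := fun x : E => c • x)
    hφ.aestronglyMeasurable (measurable_const_smul c).aemeasurable
  rw [hmap, eLpNorm_smul_measure_of_ne_zero (ENNReal.ofReal_pos.2 hpos).ne'] at h
  change _ = eLpNorm (fun x => φ (c • x)) p μ at h
  rw [← h, smul_eq_mul, ENNReal.ofReal_rpow_of_pos hpos, one_div, abs_of_pos (by positivity),
    ← Real.rpow_natCast, ← Real.rpow_neg hc.le, ← Real.rpow_mul hc.le, neg_mul]

theorem mixedNorm_le_of_le_mul {d : ℕ} (px pv : ℝ≥0∞)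
    {f : EuclideanSpace ℝ (Fin d) × EuclideanSpace ℝ (Fin d) → ℝ}
    {φ ψ : EuclideanSpace ℝ (Fin d) → ℝ} {M : ℝ} (hM : 0 ≤ M) (hψ : ∀ v, 0 ≤ ψ v)
    (hφ : eLpNorm φ px volume ≠ ⊤) (h : ∀ x v, ‖f (x, v)‖ ≤ M * φ x * ψ v) :
    mixedNorm px pv f ≤
      ENNReal.ofReal M * eLpNorm φ px volume * eLpNorm ψ pv volume := by
  have inner_le (v : EuclideanSpace ℝ (Fin d)) :
      (eLpNorm (fun x => f (x, v)) px volume).toReal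
        ≤ M * (eLpNorm φ px volume).toReal * ψ v := by
    have h1 : eLpNorm (fun x => f (x, v)) px volume
        ≤ ENNReal.ofReal (M * ψ v) * eLpNorm φ px volume := by
      rw [← Real.enorm_of_nonneg (mul_nonneg hM (hψ v)), ← eLpNorm_const_smul]
      refine eLpNorm_mono_real fun x => (h x v).trans (le_of_eq ?_)
      simp only [Pi.smul_apply, smul_eq_mul]
      ring
    refine (ENNReal.toReal_mono (ENNReal.mul_ne_top ENNReal.ofReal_ne_top hφ) h1).trans ?_
    rw [ENNReal.toReal_mul, ENNReal.toReal_ofReal (mul_nonneg hM (hψ v))]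
    exact le_of_eq (by ring)
  have hnn : 0 ≤ M * (eLpNorm φ px volume).toReal := by positivity
  calc mixedNorm px pv f
      ≤ eLpNorm ((M * (eLpNorm φ px volume).toReal) • ψ) pv volume :=
        eLpNorm_mono_real fun v => by
          rw [Real.norm_of_nonneg ENNReal.toReal_nonneg]
          exact inner_le v
    _ = _ := by
        rw [eLpNorm_const_smul, Real.enorm_of_nonneg hnn, ENNReal.ofReal_mul hM,
          ENNReal.ofReal_toReal hφ]

/-- A Gaussian with polynomial weights. -/
def weightedGaussian {E : Type*} [NormedAddCommGroup E] (α : ℝ) (k : ℕ) (y : E) : ℝ :=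
  ‖y‖ ^ α * (1 + ‖y‖) ^ k * Real.exp (-‖y‖ ^ 2 / 6)

theorem weightedGaussian_nonneg {E : Type*} [NormedAddCommGroup E] (α : ℝ) (k : ℕ) (y : E) :
    0 ≤ weightedGaussian α k y := by
  unfold weightedGaussian
  positivity

theorem continuous_weightedGaussian {E : Type*} [NormedAddCommGroup E] {α : ℝ} (hα : 0 ≤ α)
    (k : ℕ) : Continuous (weightedGaussian α k : E → ℝ) := by
  unfold weightedGaussian
  have : Continuous fun y : E => ‖y‖ ^ α := continuous_norm.rpow_const fun _ => Or.inr hα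
  fun_prop

theorem weightedGaussian_le {E : Type*} [NormedAddCommGroup E] {α : ℝ} (hα : 0 ≤ α)
    (k l : ℕ) : ∃ C : ℝ, ∀ y : E, weightedGaussian α k y ≤ C * (1 + ‖y‖) ^ (-l : ℝ) := by
  set N := ⌈α⌉₊ + k + l with hN
  refine ⟨N.factorial * Real.exp (5 / 2), fun y => ?_⟩
  have h1 : 1 ≤ 1 + ‖y‖ := by linarith [norm_nonneg y]
  have hpow : ‖y‖ ^ α ≤ (1 + ‖y‖) ^ ⌈α⌉₊ := by
    rw [← Real.rpow_natCast]
    exact (Real.rpow_le_rpow (norm_nonneg y) (by linarith) hα).trans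
      (Real.rpow_le_rpow_of_exponent_le h1 (Nat.le_ceil α))
  have hexp : (1 + ‖y‖) ^ N ≤ N.factorial * Real.exp (1 + ‖y‖) := by
    have := Real.pow_div_factorial_le_exp _ (by linarith : 0 ≤ 1 + ‖y‖) N
    rwa [div_le_iff₀' (by positivity)] at this
  rw [Real.rpow_neg (by linarith), ← div_eq_mul_inv, le_div_iff₀ (by positivity),
    Real.rpow_natCast]
  calc weightedGaussian α k y * (1 + ‖y‖) ^ l
      ≤ (1 + ‖y‖) ^ ⌈α⌉₊ * (1 + ‖y‖) ^ k * Real.exp (-‖y‖ ^ 2 / 6) * (1 + ‖y‖) ^ l := by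
        unfold weightedGaussian
        gcongr
    _ = (1 + ‖y‖) ^ N * Real.exp (-‖y‖ ^ 2 / 6) := by rw [hN]; ring
    _ ≤ N.factorial * Real.exp (1 + ‖y‖) * Real.exp (-‖y‖ ^ 2 / 6) := by gcongr
    _ = N.factorial * Real.exp (1 + ‖y‖ + -‖y‖ ^ 2 / 6) := by rw [Real.exp_add (1 + ‖y‖), mul_assoc]
    _ ≤ N.factorial * Real.exp (5 / 2) := by
        gcongr
        nlinarith [sq_nonneg (‖y‖ - 3)]

theorem eLpNorm_weightedGaussian_lt_top {E : Type*} [NormedAddCommGroup E] [NormedSpace ℝ E]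
    [MeasurableSpace E] (μ : Measure E) [hμ : μ.HasTemperateGrowth]
    {α : ℝ} (hα : 0 ≤ α) (k : ℕ) (p : ℝ≥0∞) :
    eLpNorm (weightedGaussian α k) p μ < ⊤ := by
  obtain ⟨l, hl⟩ := hμ.exists_eLpNorm_lt_top p
  obtain ⟨C, hC⟩ := weightedGaussian_le (E := E) hα k l
  refine (eLpNorm_le_mul_eLpNorm_of_ae_le_mul (c := C)
    (g := fun y : E => (1 + ‖y‖) ^ (-l : ℝ)) (Filter.Eventually.of_forall fun y => ?_) p).trans_lt
    (ENNReal.mul_lt_top ENNReal.ofReal_lt_top hl)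
  rw [Real.norm_of_nonneg (weightedGaussian_nonneg α k y), Real.norm_of_nonneg (by positivity)]
  exact hC y

/-- The polarization of the quadratic form in the exponent of `gker d 1`. -/
def kineticForm (d : ℕ) : EuclideanSpace ℝ (Fin d) × EuclideanSpace ℝ (Fin d) →L[ℝ]
    EuclideanSpace ℝ (Fin d) × EuclideanSpace ℝ (Fin d) →L[ℝ] ℝ :=
  let X := ContinuousLinearMap.fst ℝ (EuclideanSpace ℝ (Fin d)) (EuclideanSpace ℝ (Fin d))
  let V := ContinuousLinearMap.snd ℝ (EuclideanSpace ℝ (Fin d)) (EuclideanSpace ℝ (Fin d))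
  let Y := (3 : ℝ) • X - (2 : ℝ) • V
  (3 / 2 : ℝ) • (innerSL ℝ).bilinearComp X X + (1 / 2 : ℝ) • (innerSL ℝ).bilinearComp Y Y

theorem kineticForm_self {d : ℕ} (x v : EuclideanSpace ℝ (Fin d)) :
    kineticForm d (x, v) (x, v) =
      (3 * ‖x‖ ^ 2 + ‖(3 : ℝ) • x - (2 : ℝ) • v‖ ^ 2) / 2 := by
  simp only [kineticForm, add_apply, _root_.smul_apply,
    ContinuousLinearMap.bilinearComp_apply, sub_apply,
    ContinuousLinearMap.coe_fst', ContinuousLinearMap.coe_snd', innerSL_apply_apply,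
    real_inner_self_eq_norm_sq, smul_eq_mul]
  ring

theorem le_kineticForm_self {d : ℕ} (x v : EuclideanSpace ℝ (Fin d)) :
    ‖x‖ ^ 2 / 6 + ‖v‖ ^ 2 / 6 ≤ kineticForm d (x, v) (x, v) := by
  rw [kineticForm_self]
  have h : 2 * ‖v‖ ≤ 3 * ‖x‖ + ‖(3 : ℝ) • x - (2 : ℝ) • v‖ := by
    have h := norm_sub_le ((3 : ℝ) • x) ((3 : ℝ) • x - (2 : ℝ) • v)
    rwa [show (3 : ℝ) • x - ((3 : ℝ) • x - (2 : ℝ) • v) = (2 : ℝ) • v by abel, norm_smul,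
      norm_smul, Real.norm_of_nonneg (by norm_num),
      Real.norm_of_nonneg (by norm_num)] at h
  nlinarith [norm_nonneg x, norm_nonneg v, norm_nonneg ((3 : ℝ) • x - (2 : ℝ) • v),
    sq_nonneg (3 * ‖x‖ - ‖(3 : ℝ) • x - (2 : ℝ) • v‖), mul_self_le_mul_self (by positivity) h]

theorem gker_sq_eq {d : ℕ} {s : ℝ} (hs : 0 < s) (x v : EuclideanSpace ℝ (Fin d)) :
    gker d (s ^ 2) (x, v) = ((Real.pi / 3) ^ (-(d : ℝ) / 2) * s ^ (-(4 * d : ℝ))) *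
      Real.exp (-(kineticForm d (s⁻¹ ^ 3 • x, s⁻¹ • v) (s⁻¹ ^ 3 • x, s⁻¹ • v))) := by
  rw [kineticForm_self, gker]
  have h1 : (3 : ℝ) • s⁻¹ ^ 3 • x - (2 : ℝ) • s⁻¹ • v =
      s⁻¹ ^ 3 • ((3 : ℝ) • x - (2 * s ^ 2) • v) := by
    rw [smul_sub, smul_smul, smul_smul, smul_smul, smul_smul]
    congr 2 <;> field_simp
  rw [h1, norm_smul, norm_smul, Real.norm_of_nonneg (by positivity)]
  congr 1
  · rw [show Real.pi * (s ^ 2) ^ 4 / 3 = Real.pi / 3 * s ^ (8 : ℝ) by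
        rw [show (8 : ℝ) = (8 : ℕ) by norm_num, Real.rpow_natCast]; ring,
      Real.mul_rpow (by positivity) (by positivity), ← Real.rpow_mul hs.le]
    ring_nf
  · congr 1
    field_simp

/-- Gaussian bound for the weighted derivatives of the kernel at time `s ^ 2`. -/
theorem exists_weighted_deriv_gker_le (d : ℕ) (α β : ℝ) (m n : ℕ) :
    ∃ K : ℝ, 0 ≤ K ∧ ∀ s : ℝ, 0 < s → ∀ x v : EuclideanSpace ℝ (Fin d),
      ‖x‖ ^ α * ‖v‖ ^ β * ‖iteratedFDeriv ℝ n
          (fun v' => iteratedFDeriv ℝ m (fun x' => gker d (s ^ 2) (x', v')) x) v‖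
        ≤ K * s ^ (3 * (α - m) + (β - n) - 4 * d) *
          weightedGaussian α (n + m) (s⁻¹ ^ 3 • x) * weightedGaussian β (n + m) (s⁻¹ • v) := by
  obtain ⟨K, hK, hbound⟩ := exists_norm_iteratedFDeriv_exp_neg_bilinear_le (kineticForm d) (n + m)
  refine ⟨(Real.pi / 3) ^ (-(d : ℝ) / 2) * K, by positivity, fun s hs x v => ?_⟩
  set c : ℝ := (Real.pi / 3) ^ (-(d : ℝ) / 2) with hc
  have hc0 : 0 ≤ c := by positivity
  set q : ℝ := s ^ (-(4 * d : ℝ)) with hq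
  have hq0 : 0 ≤ q := by positivity
  set A := s⁻¹ ^ 3 •
    ContinuousLinearMap.inl ℝ (EuclideanSpace ℝ (Fin d)) (EuclideanSpace ℝ (Fin d)) with hA
  set B := s⁻¹ •
    ContinuousLinearMap.inr ℝ (EuclideanSpace ℝ (Fin d)) (EuclideanSpace ℝ (Fin d)) with hB
  have hAB (x' v' : EuclideanSpace ℝ (Fin d)) : A x' + B v' = (s⁻¹ ^ 3 • x', s⁻¹ • v') := by
    simp [hA, hB]
  have hnA : ‖A‖ ≤ s⁻¹ ^ 3 := by
    rw [hA, norm_smul, Real.norm_of_nonneg (by positivity)]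
    exact mul_le_of_le_one_right (by positivity) (ContinuousLinearMap.norm_inl_le_one ℝ _ _)
  have hnB : ‖B‖ ≤ s⁻¹ := by
    rw [hB, norm_smul, Real.norm_of_nonneg (by positivity)]
    exact mul_le_of_le_one_right (by positivity) (ContinuousLinearMap.norm_inr_le_one ℝ _ _)
  have hexp : ContDiff ℝ ⊤ fun z => Real.exp (-(kineticForm d z z)) := by fun_prop
  have hf : ContDiff ℝ ⊤ fun z => (c * q) • Real.exp (-(kineticForm d z z)) := by fun_prop
  have hgker (x' v' : EuclideanSpace ℝ (Fin d)) : gker d (s ^ 2) (x', v') =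
      (c * q) • Real.exp (-(kineticForm d (A x' + B v') (A x' + B v'))) := by
    rw [gker_sq_eq hs, hAB]
    rfl
  have hderiv := norm_iteratedFDeriv_iteratedFDeriv_comp_add_le hf A B n m x v
  simp only [hgker]
  rw [iteratedFDeriv_const_smul_apply' (hexp.contDiffAt.of_le le_top), norm_smul (c * q),
    Real.norm_of_nonneg (mul_nonneg hc0 hq0), hAB] at hderiv
  set X := s⁻¹ ^ 3 • x with hX
  set V := s⁻¹ • v with hV
  have hz : 1 + ‖(X, V)‖ ≤ (1 + ‖X‖) * (1 + ‖V‖) := by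
    rw [Prod.norm_mk]
    have := mul_nonneg (norm_nonneg X) (norm_nonneg V)
    have := max_le_add_of_nonneg (norm_nonneg X) (norm_nonneg V)
    linarith
  have hker : ‖iteratedFDeriv ℝ (n + m) (fun z => Real.exp (-(kineticForm d z z))) (X, V)‖
      ≤ K * ((1 + ‖X‖) * (1 + ‖V‖)) ^ (n + m) *
        (Real.exp (-‖X‖ ^ 2 / 6) * Real.exp (-‖V‖ ^ 2 / 6)) := by
    refine (hbound (X, V)).trans ?_
    rw [← Real.exp_add]
    have := le_kineticForm_self X V
    gcongr
    linarith
  have hx : ‖x‖ ^ α = s ^ (3 * α) * ‖X‖ ^ α := by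
    have : ‖x‖ = s ^ (3 : ℝ) * ‖X‖ := by
      rw [hX, norm_smul, Real.norm_of_nonneg (by positivity), show (3 : ℝ) = (3 : ℕ) by norm_num,
        Real.rpow_natCast]
      field_simp
    rw [this, Real.mul_rpow (by positivity) (norm_nonneg _), ← Real.rpow_mul hs.le]
  have hv : ‖v‖ ^ β = s ^ β * ‖V‖ ^ β := by
    have : ‖v‖ = s * ‖V‖ := by
      rw [hV, norm_smul, Real.norm_of_nonneg (by positivity)]
      field_simp
    rw [this, Real.mul_rpow hs.le (norm_nonneg _)]
  have hsm : (s⁻¹ ^ 3) ^ m = s ^ (-(3 * m : ℝ)) := by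
    rw [← pow_mul, Real.rpow_neg hs.le, inv_pow, ← Real.rpow_natCast]
    push_cast
    rfl
  have hsn : s⁻¹ ^ n = s ^ (-(n : ℝ)) := by
    rw [Real.rpow_neg hs.le, inv_pow, Real.rpow_natCast]
  have hpow : s ^ (3 * (α - m) + (β - n) - 4 * d) =
      s ^ (3 * α) * s ^ β * s ^ (-(3 * m : ℝ)) * s ^ (-(n : ℝ)) * q := by
    rw [hq, ← Real.rpow_add hs, ← Real.rpow_add hs, ← Real.rpow_add hs, ← Real.rpow_add hs]
    ring_nf
  calc _ ≤ ‖x‖ ^ α * ‖v‖ ^ β * ((s⁻¹ ^ 3) ^ m * s⁻¹ ^ n * (c * q *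
          (K * ((1 + ‖X‖) * (1 + ‖V‖)) ^ (n + m) *
            (Real.exp (-‖X‖ ^ 2 / 6) * Real.exp (-‖V‖ ^ 2 / 6))))) := by
        refine mul_le_mul_of_nonneg_left (hderiv.trans ?_) (by positivity)
        gcongr
    _ = _ := by
        rw [hx, hv, hsm, hsn, hpow, weightedGaussian, weightedGaussian, mul_pow]
        ring

/-- Weighted mixed-norm estimates for derivatives of the kinetic kernel:
`‖ |x|^α |v|^β |∇_x^m ∇_v^n g_t| ‖_𝐩 ≤ C t^{3(α-m)/2 + (β-n)/2 - 𝐚·(d/2)(1-1/𝐩)}`. -/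
theorem gker_weighted_deriv_mixedNorm_bound (d : ℕ) (α β : ℝ) (hα : 0 ≤ α) (hβ : 0 ≤ β)
    (m n : ℕ) (px pv : ℝ≥0∞) (hpx : 1 ≤ px) (hpv : 1 ≤ pv) :
    ∃ C : ℝ, 0 < C ∧ ∀ t : ℝ, 0 < t → t ≤ 1 →
      mixedNorm px pv
          (fun z => ‖z.1‖ ^ α * ‖z.2‖ ^ β *
            ‖iteratedFDeriv ℝ n
              (fun v' => iteratedFDeriv ℝ m (fun x' => gker d t (x', v')) z.1) z.2‖)
        ≤ ENNReal.ofReal (C * t ^ (3 * (α - m) / 2 + (β - n) / 2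
            - ((3 * (d : ℝ) / 2) * (1 - (px⁻¹).toReal)
              + ((d : ℝ) / 2) * (1 - (pv⁻¹).toReal)))) := by
  obtain ⟨K, hK, hbound⟩ := exists_weighted_deriv_gker_le d α β m n
  set Φ := eLpNorm (weightedGaussian α (n + m) : EuclideanSpace ℝ (Fin d) → ℝ) px volume with hΦ
  set Ψ := eLpNorm (weightedGaussian β (n + m) : EuclideanSpace ℝ (Fin d) → ℝ) pv volume with hΨ
  have hΦt : Φ ≠ ⊤ := (eLpNorm_weightedGaussian_lt_top volume hα _ _).ne
  have hΨt : Ψ ≠ ⊤ := (eLpNorm_weightedGaussian_lt_top volume hβ _ _).ne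
  refine ⟨K * Φ.toReal * Ψ.toReal + 1, by positivity, fun t ht _ => ?_⟩
  obtain ⟨s, hs, rfl⟩ : ∃ s : ℝ, 0 < s ∧ s ^ 2 = t := ⟨√t, Real.sqrt_pos.2 ht, Real.sq_sqrt ht.le⟩
  have hs3 : 0 < s⁻¹ ^ 3 := by positivity
  have hφ := eLpNorm_comp_const_smul_real (volume : Measure (EuclideanSpace ℝ (Fin d)))
    (continuous_weightedGaussian hα (n + m)) px hs3
  have hψ := eLpNorm_comp_const_smul_real (volume : Measure (EuclideanSpace ℝ (Fin d)))
    (continuous_weightedGaussian hβ (n + m)) pv (inv_pos.2 hs)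
  rw [finrank_euclideanSpace_fin] at hφ hψ
  set M : ℝ := K * s ^ (3 * (α - m) + (β - n) - 4 * d) with hM
  have hM0 : 0 ≤ M := by positivity
  refine (mixedNorm_le_of_le_mul px pv hM0
    (φ := fun x => weightedGaussian α (n + m) (s⁻¹ ^ 3 • x))
    (ψ := fun v => weightedGaussian β (n + m) (s⁻¹ • v))
    (fun v => weightedGaussian_nonneg _ _ _) ?_ fun x v => ?_).trans ?_
  · rw [hφ]
    exact ENNReal.mul_ne_top ENNReal.ofReal_ne_top hΦt
  · rw [Real.norm_of_nonneg (by positivity)]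
    exact hbound s hs x v
  rw [hφ, hψ, ← hΦ, ← hΨ, ← ENNReal.ofReal_toReal hΦt, ← ENNReal.ofReal_toReal hΨt,
    ← ENNReal.ofReal_mul (by positivity), ← ENNReal.ofReal_mul (by positivity),
    ← ENNReal.ofReal_mul (by positivity), ← ENNReal.ofReal_mul (by positivity),
    ENNReal.toReal_ofReal ENNReal.toReal_nonneg, ENNReal.toReal_ofReal ENNReal.toReal_nonneg]
  refine ENNReal.ofReal_le_ofReal ?_
  set E : ℝ := 3 * (α - m) / 2 + (β - n) / 2
    - ((3 * (d : ℝ) / 2) * (1 - (px⁻¹).toReal) + ((d : ℝ) / 2) * (1 - (pv⁻¹).toReal)) with hE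
  have hpow : (s ^ 2) ^ E = s ^ (3 * (α - m) + (β - n) - 4 * d) *
      (s⁻¹ ^ 3) ^ (-(d * (px⁻¹).toReal)) * s⁻¹ ^ (-(d * (pv⁻¹).toReal)) := by
    rw [← Real.rpow_natCast s 2, ← Real.rpow_natCast s⁻¹ 3, ← Real.rpow_mul (inv_pos.2 hs).le,
      Real.inv_rpow hs.le, Real.inv_rpow hs.le, ← Real.rpow_neg hs.le, ← Real.rpow_neg hs.le,
      ← Real.rpow_mul hs.le, ← Real.rpow_add hs, ← Real.rpow_add hs, hE]
    congr 1
    push_cast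
    ring
  calc _ = K * Φ.toReal * Ψ.toReal * (s ^ 2) ^ E := by rw [hpow, hM]; ring
    _ ≤ _ := by gcongr; linarith
end
end

section
/- Let $\alpha,\beta\ge 0$, $m,n\in\mathbb{N}_0$, $\mathbf{p}\in[1,\infty]^2$. With $\Gamma_t f(x,v)=f(x+tv,v)$ and $g_t$ the kinetic heat kernel, there is a constant $C$ such that for all $t\in(0,1]$: $\big\||x|^\alpha|v|^\beta|\nabla_x^m\nabla_v^n \partial_t(\Gamma_t g_t)(x,v)|\big\|_{\mathbf{p}} \le C\, t^{\frac{3(\alpha-m)+(\beta-n)-2}{2} - \mathbf{a}\cdot\frac{d}{2}(1-\frac{1}{\mathbf{p}})}$. -/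
open MeasureTheory Real ENNReal

noncomputable section

/-- `∂_t (Γ_t g_t)(x,v)`, the time derivative of the sheared kinetic kernel. -/
def ptShearKer (d : ℕ) (t : ℝ)
    (z : EuclideanSpace ℝ (Fin d) × EuclideanSpace ℝ (Fin d)) : ℝ :=
  deriv (fun τ : ℝ => gker d τ (z.1 + τ • z.2, z.2)) t

section

open scoped SchwartzMap Nat

/-- The `L^p` norm of a dilated function. -/
lemma eLpNorm_comp_const_smul {E : Type*} [NormedAddCommGroup E] [NormedSpace ℝ E]
    [MeasurableSpace E] [BorelSpace E] [FiniteDimensional ℝ E] (μ : Measure E)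
    [μ.IsAddHaarMeasure] (f : E → ℝ) (p : ℝ≥0∞) {c : ℝ} (hc : 0 < c) :
    eLpNorm (fun x => f (c • x)) p μ =
      ENNReal.ofReal (c ^ (-(Module.finrank ℝ E : ℝ) * (p⁻¹).toReal)) * eLpNorm f p μ := by
  have hemb : MeasurableEmbedding (fun x : E => c • x) :=
    (Homeomorph.smulOfNeZero c hc.ne').measurableEmbedding
  have hpow : 0 < (c ^ Module.finrank ℝ E)⁻¹ := by positivity
  change eLpNorm (f ∘ fun x : E => c • x) p μ = _
  rw [← hemb.eLpNorm_map_measure, Measure.map_addHaar_smul μ hc.ne', abs_of_pos hpow,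
    eLpNorm_smul_measure_of_ne_zero (by simpa using hpow), smul_eq_mul,
    ENNReal.ofReal_rpow_of_pos hpow, one_div, ← Real.rpow_natCast, ← Real.rpow_neg hc.le,
    ← Real.rpow_mul hc.le]

/-- A pointwise bound by a product of dilated profiles controls the mixed norm. -/
lemma mixedNorm_le_of_le_mul_s8 {d : ℕ} {px pv : ℝ≥0∞}
    {F : EuclideanSpace ℝ (Fin d) × EuclideanSpace ℝ (Fin d) → ℝ}
    {f₁ f₂ : EuclideanSpace ℝ (Fin d) → ℝ}
    (hf₁ : eLpNorm f₁ px volume < ⊤) (hf₂ : eLpNorm f₂ pv volume < ⊤)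
    {A a b : ℝ} (hA : 0 ≤ A) (ha : 0 < a) (hb : 0 < b)
    (h : ∀ x v, ‖F (x, v)‖ ≤ A * ‖f₁ (a • x)‖ * ‖f₂ (b • v)‖) :
    mixedNorm px pv F ≤ ENNReal.ofReal
      (A * a ^ (-(d : ℝ) * (px⁻¹).toReal) * b ^ (-(d : ℝ) * (pv⁻¹).toReal) *
        (eLpNorm f₁ px volume).toReal * (eLpNorm f₂ pv volume).toReal) := by
  set Nf₁ := (eLpNorm f₁ px volume).toReal with hNf₁
  set Nf₂ := (eLpNorm f₂ pv volume).toReal with hNf₂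
  have hf₁' : eLpNorm f₁ px volume = ENNReal.ofReal Nf₁ := (ENNReal.ofReal_toReal hf₁.ne).symm
  have hf₂' : eLpNorm f₂ pv volume = ENNReal.ofReal Nf₂ := (ENNReal.ofReal_toReal hf₂.ne).symm
  set ea := a ^ (-(d : ℝ) * (px⁻¹).toReal) with hea
  set eb := b ^ (-(d : ℝ) * (pv⁻¹).toReal) with heb
  have hea0 : 0 ≤ ea := by positivity
  have heb0 : 0 ≤ eb := by positivity
  have hN0 : 0 ≤ Nf₁ := ENNReal.toReal_nonneg
  have inner_le (v) : (eLpNorm (fun x => F (x, v)) px volume).toReal ≤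
      A * ea * Nf₁ * ‖f₂ (b • v)‖ := by
    refine ENNReal.toReal_le_of_le_ofReal (by positivity) ?_
    have hle := eLpNorm_le_mul_eLpNorm_of_ae_le_mul (μ := volume) (p := px)
      (f := fun x => F (x, v)) (g := fun x => f₁ (a • x)) (c := A * ‖f₂ (b • v)‖)
      (Filter.Eventually.of_forall fun x => (h x v).trans_eq (by ring))
    refine hle.trans_eq ?_
    rw [eLpNorm_comp_const_smul volume f₁ px ha, hf₁', finrank_euclideanSpace_fin, ← hea,
      ← ENNReal.ofReal_mul hea0, ← ENNReal.ofReal_mul (by positivity)]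
    congr 1; ring
  have hle := eLpNorm_le_mul_eLpNorm_of_ae_le_mul (μ := volume) (p := pv)
    (f := fun v => (eLpNorm (fun x => F (x, v)) px volume).toReal)
    (g := fun v => f₂ (b • v)) (c := A * ea * Nf₁)
    (Filter.Eventually.of_forall fun v => by
      rw [Real.norm_of_nonneg ENNReal.toReal_nonneg]
      exact inner_le v)
  refine hle.trans_eq ?_
  rw [eLpNorm_comp_const_smul volume f₂ pv hb, hf₂', finrank_euclideanSpace_fin, ← heb,
    ← ENNReal.ofReal_mul heb0, ← ENNReal.ofReal_mul (by positivity)]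
  congr 1; ring

/-- Iterated derivatives of a Schwartz function along a linear family of directions are again
given by a Schwartz function. -/
lemma SchwartzMap.exists_iteratedFDeriv_comp_clm {D Z F : Type*}
    [NormedAddCommGroup D] [NormedSpace ℝ D] [NormedAddCommGroup Z] [NormedSpace ℝ Z]
    [NormedAddCommGroup F] [NormedSpace ℝ F] (f : 𝓢(Z, F)) (L : D →L[ℝ] Z) (m : ℕ) :
    ∃ g : 𝓢(Z, D [×m]→L[ℝ] F), ∀ z y,
      g (z + L y) = iteratedFDeriv ℝ m (fun y' => f (z + L y')) y := by
  induction m with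
  | zero =>
    refine ⟨postcompCLM (𝕜 := ℝ)
      (continuousMultilinearCurryFin0 ℝ D F).symm.toContinuousLinearEquiv.toContinuousLinearMap f,
      fun z y => ?_⟩
    rw [postcompCLM_apply, iteratedFDeriv_zero_eq_comp]
    rfl
  | succ m ih =>
    obtain ⟨g, hg⟩ := ih
    refine ⟨postcompCLM (𝕜 := ℝ)
      ((continuousMultilinearCurryLeftEquiv ℝ (fun _ : Fin (m + 1) => D)
        F).symm.toContinuousLinearEquiv.toContinuousLinearMap ∘L
        (ContinuousLinearMap.compL ℝ D Z (D [×m]→L[ℝ] F)).flip L) (fderivCLM ℝ Z _ g),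
      fun z y => ?_⟩
    have hfun : iteratedFDeriv ℝ m (fun y' => f (z + L y')) = fun y' => g (z + L y') :=
      funext fun y' => (hg z y').symm
    have hder : fderiv ℝ (fun y' => g (z + L y')) y = (fderiv ℝ g (z + L y)).comp L :=
      (g.differentiableAt.hasFDerivAt.comp y (L.hasFDerivAt.const_add z)).fderiv
    rw [postcompCLM_apply, iteratedFDeriv_succ_eq_comp_left, hfun, Function.comp_apply, hder,
      fderivCLM_apply]
    rfl

/-- Mixed iterated partial derivatives of a Schwartz function on a product are Schwartz. -/
lemma SchwartzMap.exists_iteratedFDeriv_iteratedFDeriv {E₁ E₂ F : Type*}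
    [NormedAddCommGroup E₁] [NormedSpace ℝ E₁] [NormedAddCommGroup E₂] [NormedSpace ℝ E₂]
    [NormedAddCommGroup F] [NormedSpace ℝ F] (f : 𝓢(E₁ × E₂, F)) (m n : ℕ) :
    ∃ (g : 𝓢(E₁ × E₂, E₁ [×m]→L[ℝ] F)) (h : 𝓢(E₁ × E₂, E₂ [×n]→L[ℝ] (E₁ [×m]→L[ℝ] F))),
      (∀ x v, g (x, v) = iteratedFDeriv ℝ m (fun x' => f (x', v)) x) ∧
      ∀ x v, h (x, v) = iteratedFDeriv ℝ n (fun v' => g (x, v')) v := by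
  obtain ⟨g, hg⟩ := f.exists_iteratedFDeriv_comp_clm (ContinuousLinearMap.inl ℝ E₁ E₂) m
  obtain ⟨h, hh⟩ := g.exists_iteratedFDeriv_comp_clm (ContinuousLinearMap.inr ℝ E₁ E₂) n
  refine ⟨g, h, fun x v => ?_, fun x v => ?_⟩
  · simpa using hg (0, v) x
  · simpa using hh (x, 0) v

/-- The exponential of minus a function of temperate growth, growing at least like the norm, is a
Schwartz function. -/
lemma exists_schwartzMap_exp_neg {Z : Type*} [NormedAddCommGroup Z] [NormedSpace ℝ Z]
    {Q : Z → ℝ} (hQ : Q.HasTemperateGrowth) {B : ℝ} (hB : ∀ z, ‖z‖ - B ≤ Q z) :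
    ∃ g : 𝓢(Z, ℝ), ∀ z, g z = Real.exp (-Q z) := by
  have hQ' : (fun z => -Q z).HasTemperateGrowth := hQ.fun_neg
  refine ⟨⟨fun z => Real.exp (-Q z), Real.contDiff_exp.comp hQ'.1, fun k n => ?_⟩, fun z => rfl⟩
  obtain ⟨l, C, hC, hl⟩ := hQ'.norm_iteratedFDeriv_le_uniform n
  refine ⟨n ! * (1 + C) ^ n * ((k + l * n)! * Real.exp (1 + B)), fun z => ?_⟩
  have hbound : ‖iteratedFDeriv ℝ n (Real.exp ∘ fun z => -Q z) z‖ ≤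
      n ! * Real.exp (-Q z) * ((1 + C) * (1 + ‖z‖) ^ l) ^ n := by
    refine norm_iteratedFDeriv_comp_le Real.contDiff_exp hQ'.1 (mod_cast le_top) z
      (fun i _ => ?_) (fun i hi hin => ?_)
    · rw [norm_iteratedFDeriv_eq_norm_iteratedDeriv, iteratedDeriv_eq_iterate,
        Real.iter_deriv_exp, Real.norm_of_nonneg (Real.exp_pos _).le]
    · calc _ ≤ C * (1 + ‖z‖) ^ l := hl i hin z
        _ ≤ (1 + C) * (1 + ‖z‖) ^ l := by gcongr; simp
        _ ≤ _ := le_self_pow₀ (one_le_mul_of_one_le_of_one_le (by simp [hC])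
            (one_le_pow₀ (by simp))) (by lia)
  have hexp : (1 + ‖z‖) ^ (k + l * n) * Real.exp (-Q z) ≤ (k + l * n)! * Real.exp (1 + B) := by
    have h1 := Real.pow_div_factorial_le_exp (1 + ‖z‖) (by positivity) (k + l * n)
    rw [div_le_iff₀ (by positivity)] at h1
    calc _ ≤ Real.exp (1 + ‖z‖) * (k + l * n)! * Real.exp (B - ‖z‖) := by
          gcongr; linarith [hB z]
      _ = _ := by
          rw [mul_right_comm, ← Real.exp_add, mul_comm]; congr 2; ring
  calc ‖z‖ ^ k * ‖iteratedFDeriv ℝ n (Real.exp ∘ fun z => -Q z) z‖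
      ≤ (1 + ‖z‖) ^ k * (n ! * Real.exp (-Q z) * ((1 + C) * (1 + ‖z‖) ^ l) ^ n) := by
        gcongr; simp
    _ = n ! * (1 + C) ^ n * ((1 + ‖z‖) ^ (k + l * n) * Real.exp (-Q z)) := by
        rw [mul_pow, ← pow_mul, pow_add]; ring
    _ ≤ _ := by gcongr

/-- Parabolic scaling of `∂_t (Γ_t g_t)`. -/
lemma ptShearKer_scaling (d : ℕ) {t : ℝ} (ht : 0 < t) (x v : EuclideanSpace ℝ (Fin d)) :
    ptShearKer d t (x, v) = t ^ (-2 * (d : ℝ) - 1) *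
      ptShearKer d 1 (t ^ (-3 / 2 : ℝ) • x, t ^ (-1 / 2 : ℝ) • v) := by
  set a := t ^ (-3 / 2 : ℝ) with ha
  set b := t ^ (-1 / 2 : ℝ) with hb
  have hba : b = a * t := by
    rw [ha, hb, ← Real.rpow_add_one ht.ne']; norm_num
  have ha2 : a ^ 2 = (t ^ 3)⁻¹ := by
    rw [ha, ← Real.rpow_mul_natCast ht.le, ← Real.rpow_natCast t 3, ← Real.rpow_neg ht.le]
    norm_num
  have hnorm (w : EuclideanSpace ℝ (Fin d)) : ‖a • w‖ ^ 2 = (t ^ 3)⁻¹ * ‖w‖ ^ 2 := by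
    rw [norm_smul, mul_pow, Real.norm_eq_abs, sq_abs, ha2]
  have hker (τ : ℝ) : gker d (t * τ) (x + (t * τ) • v, v) =
      t ^ (-2 * (d : ℝ)) * gker d τ (a • x + τ • b • v, b • v) := by
    have h1 : a • x + τ • b • v = a • (x + (t * τ) • v) := by
      rw [hba]; module
    have h2 : (3 : ℝ) • (a • x + τ • b • v) - (2 * τ) • b • v =
        a • ((3 : ℝ) • (x + (t * τ) • v) - (2 * (t * τ)) • v) := by
      rw [hba]; module
    have h3 : (Real.pi * (t * τ) ^ 4 / 3) ^ (-(d : ℝ) / 2) =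
        t ^ (-2 * (d : ℝ)) * (Real.pi * τ ^ 4 / 3) ^ (-(d : ℝ) / 2) := by
      rw [show Real.pi * (t * τ) ^ 4 / 3 = t ^ 4 * (Real.pi * τ ^ 4 / 3) by ring,
        Real.mul_rpow (by positivity) (by positivity), ← Real.rpow_natCast t 4,
        ← Real.rpow_mul ht.le]
      congr 2; push_cast; ring
    unfold gker
    simp only
    rw [h2, h1, h3, mul_assoc, hnorm, hnorm]
    congr 3
    ring
  have hd := deriv_comp_mul_left t (fun τ : ℝ => gker d τ (x + τ • v, v)) 1
  simp only [hker, mul_one, smul_eq_mul, deriv_const_mul_field'] at hd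
  unfold ptShearKer
  simp only
  rw [Real.rpow_sub_one ht.ne', div_mul_eq_mul_div, eq_div_iff ht.ne', mul_comm, ← hd]

/-- The time derivative at unit time is a quadratic polynomial times a Gaussian. -/
lemma exists_ptShearKer_one_eq (d : ℕ) : ∃ c₁ c₂ : ℝ, ∀ z, ptShearKer d 1 z =
    (c₁ + c₂ * (9 * ‖z.1‖ ^ 2 + 6 * inner ℝ z.1 z.2 + ‖z.2‖ ^ 2)) *
      Real.exp (-(6 * ‖z.1‖ ^ 2 + 6 * inner ℝ z.1 z.2 + 2 * ‖z.2‖ ^ 2)) := by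
  refine ⟨Real.pi * 4 / 3 * (-(d : ℝ) / 2) * (Real.pi / 3) ^ (-(d : ℝ) / 2 - 1),
    2 * (Real.pi / 3) ^ (-(d : ℝ) / 2), fun ⟨x, v⟩ => ?_⟩
  have hfun : (fun τ : ℝ => gker d τ (x + τ • v, v)) = fun τ : ℝ =>
      (Real.pi * τ ^ 4 / 3) ^ (-(d : ℝ) / 2) * Real.exp
        (-(12 * ‖x‖ ^ 2 + 12 * inner ℝ x v * τ + 4 * ‖v‖ ^ 2 * τ ^ 2) / (2 * τ ^ 3)) := by
    ext τ
    have h1 : (3 : ℝ) • (x + τ • v) - (2 * τ) • v = (3 : ℝ) • x + τ • v := by module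
    unfold gker
    simp only
    rw [h1, norm_add_sq_real, norm_add_sq_real]
    simp only [norm_smul, inner_smul_left, inner_smul_right, mul_pow, Real.norm_eq_abs, sq_abs,
      conj_trivial]
    congr 4
    ring
  have hp : HasDerivAt (fun τ : ℝ => Real.pi * τ ^ 4 / 3) (Real.pi * 4 / 3) 1 := by
    simpa using ((hasDerivAt_pow 4 (1 : ℝ)).const_mul Real.pi).div_const 3
  have hp' := hp.rpow_const (p := -(d : ℝ) / 2) (Or.inl (by positivity))
  have hn : HasDerivAt
      (fun τ : ℝ => -(12 * ‖x‖ ^ 2 + 12 * inner ℝ x v * τ + 4 * ‖v‖ ^ 2 * τ ^ 2))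
      (-(12 * inner ℝ x v + 8 * ‖v‖ ^ 2)) 1 := by
    refine (((((hasDerivAt_id' (1 : ℝ)).const_mul (12 * inner ℝ x v)).const_add
      (12 * ‖x‖ ^ 2)).add ((hasDerivAt_pow 2 (1 : ℝ)).const_mul (4 * ‖v‖ ^ 2))).neg).congr_deriv ?_
    norm_num; ring
  have hq : HasDerivAt (fun τ : ℝ => 2 * τ ^ 3) 6 1 :=
    ((hasDerivAt_pow 3 (1 : ℝ)).const_mul 2).congr_deriv (by norm_num)
  have hd := (hp'.mul (hn.div hq (by norm_num)).exp).deriv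
  unfold ptShearKer
  simp only
  rw [hfun]
  refine hd.trans ?_
  have he : -(12 * ‖x‖ ^ 2 + 12 * inner ℝ x v + 4 * ‖v‖ ^ 2) / 2 =
      -(6 * ‖x‖ ^ 2 + 6 * inner ℝ x v + 2 * ‖v‖ ^ 2) := by ring
  simp only [Pi.div_apply, one_pow, mul_one, he]
  ring

/-- `∂_t (Γ_t g_t)` at `t = 1` is a Schwartz function. -/
lemma exists_schwartzMap_ptShearKer_one (d : ℕ) :
    ∃ G : 𝓢(EuclideanSpace ℝ (Fin d) × EuclideanSpace ℝ (Fin d), ℝ),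
      ∀ z, G z = ptShearKer d 1 z := by
  let E := EuclideanSpace ℝ (Fin d)
  have hfst : (fun z : E × E => z.1).HasTemperateGrowth :=
    (ContinuousLinearMap.fst ℝ E E).hasTemperateGrowth
  have hsnd : (fun z : E × E => z.2).HasTemperateGrowth :=
    (ContinuousLinearMap.snd ℝ E E).hasTemperateGrowth
  have hX : (fun z : E × E => ‖z.1‖ ^ 2).HasTemperateGrowth :=
    (Function.hasTemperateGrowth_norm_sq E).comp hfst
  have hV : (fun z : E × E => ‖z.2‖ ^ 2).HasTemperateGrowth :=
    (Function.hasTemperateGrowth_norm_sq E).comp hsnd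
  have hI : (fun z : E × E => (inner ℝ z.1 z.2 : ℝ)).HasTemperateGrowth :=
    (innerSL ℝ (E := E)).bilinear_hasTemperateGrowth hfst hsnd
  have hQ : (fun z : E × E =>
      6 * ‖z.1‖ ^ 2 + 6 * inner ℝ z.1 z.2 + 2 * ‖z.2‖ ^ 2).HasTemperateGrowth := by fun_prop
  obtain ⟨c₁, c₂, hc⟩ := exists_ptShearKer_one_eq d
  have hP : (fun z : E × E =>
      c₁ + c₂ * (9 * ‖z.1‖ ^ 2 + 6 * inner ℝ z.1 z.2 + ‖z.2‖ ^ 2)).HasTemperateGrowth := by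
    fun_prop
  obtain ⟨g, hg⟩ := exists_schwartzMap_exp_neg hQ (B := 1 / 2) fun z => by
    have hI := (abs_le.1 (abs_real_inner_le_norm z.1 z.2)).1
    rw [Prod.norm_def]
    rcases max_cases ‖z.1‖ ‖z.2‖ with ⟨h, -⟩ | ⟨h, -⟩ <;> rw [h] <;>
      nlinarith [sq_nonneg (‖z.1‖ - ‖z.2‖ / 2), sq_nonneg (‖z.2‖ - 3 / 2 * ‖z.1‖),
        sq_nonneg (‖z.1‖ - 1), sq_nonneg (‖z.2‖ - 1)]
  exact ⟨SchwartzMap.smulLeftCLM ℝ _ g, fun z => by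
    rw [SchwartzMap.smulLeftCLM_apply_apply hP, hg, hc, smul_eq_mul]⟩

/-- Weighted Schwartz functions on a product are bounded by products of polynomially decaying
profiles. -/
lemma SchwartzMap.exists_weighted_le {E₁ E₂ F : Type*}
    [NormedAddCommGroup E₁] [NormedSpace ℝ E₁] [NormedAddCommGroup E₂] [NormedSpace ℝ E₂]
    [NormedAddCommGroup F] [NormedSpace ℝ F] (h : 𝓢(E₁ × E₂, F)) {α β : ℝ} (hα : 0 ≤ α)
    (hβ : 0 ≤ β) (k l : ℕ) :
    ∃ K : ℝ, 0 ≤ K ∧ ∀ x v, ‖x‖ ^ α * ‖v‖ ^ β * ‖h (x, v)‖ ≤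
      K * (1 + ‖x‖) ^ (-k : ℝ) * (1 + ‖v‖) ^ (-l : ℝ) := by
  set M := ⌈α⌉₊ + ⌈β⌉₊ + k + l
  refine ⟨2 ^ M * ((Finset.Iic (M, 0)).sup fun m => SchwartzMap.seminorm ℝ m.1 m.2) h,
    by positivity, fun x v => ?_⟩
  have hM := one_add_le_sup_seminorm_apply (𝕜 := ℝ) (m := (M, 0)) le_rfl le_rfl h (x, v)
  rw [norm_iteratedFDeriv_zero] at hM
  rw [Real.rpow_neg (by positivity), Real.rpow_neg (by positivity), Real.rpow_natCast,
    Real.rpow_natCast, ← div_eq_mul_inv, ← div_eq_mul_inv, le_div_iff₀ (by positivity),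
    le_div_iff₀ (by positivity)]
  refine le_trans ?_ hM
  have hx : ‖x‖ ≤ ‖(x, v)‖ := norm_fst_le (x, v)
  have hv : ‖v‖ ≤ ‖(x, v)‖ := norm_snd_le (x, v)
  have hpow {r γ : ℝ} (hr : 0 ≤ r) (hγ : 0 ≤ γ) (hrz : r ≤ ‖(x, v)‖) :
      r ^ γ ≤ (1 + ‖(x, v)‖) ^ ⌈γ⌉₊ := by
    rw [← Real.rpow_natCast]
    exact (Real.rpow_le_rpow hr (hrz.trans (by simp)) hγ).trans
      (Real.rpow_le_rpow_of_exponent_le (by simp) (Nat.le_ceil γ))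
  calc ‖x‖ ^ α * ‖v‖ ^ β * ‖h (x, v)‖ * (1 + ‖v‖) ^ l * (1 + ‖x‖) ^ k
      ≤ (1 + ‖(x, v)‖) ^ ⌈α⌉₊ * (1 + ‖(x, v)‖) ^ ⌈β⌉₊ * ‖h (x, v)‖ *
        (1 + ‖(x, v)‖) ^ l * (1 + ‖(x, v)‖) ^ k := by
        gcongr
        · exact hpow (norm_nonneg x) hα hx
        · exact hpow (norm_nonneg v) hβ hv
    _ = _ := by simp only [M, pow_add]; ring

/-- Derivatives of a dilated and rescaled function of two variables. -/
lemma SchwartzMap.iteratedFDeriv_iteratedFDeriv_dilation {E₁ E₂ : Type*}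
    [NormedAddCommGroup E₁] [NormedSpace ℝ E₁] [NormedAddCommGroup E₂] [NormedSpace ℝ E₂]
    {m n : ℕ} {f : 𝓢(E₁ × E₂, ℝ)} {g : 𝓢(E₁ × E₂, E₁ [×m]→L[ℝ] ℝ)}
    (hg : ∀ x v, g (x, v) = iteratedFDeriv ℝ m (fun x' => f (x', v)) x)
    (k a b : ℝ) (x : E₁) (v : E₂) :
    iteratedFDeriv ℝ n (fun v' =>
      iteratedFDeriv ℝ m (fun x' => k * f (a • x', b • v')) x) v =
      (k * a ^ m * b ^ n) • iteratedFDeriv ℝ n (fun v' => g (a • x, v')) (b • v) := by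
  have hx (w : E₂) : ContDiff ℝ m fun x' => f (x', w) :=
    (f.smooth m).comp (contDiff_id.prodMk contDiff_const)
  have hv : ContDiff ℝ n fun v' => g (a • x, v') :=
    (g.smooth n).comp (contDiff_const.prodMk contDiff_id)
  have hin (v' : E₂) : iteratedFDeriv ℝ m (fun x' => k * f (a • x', b • v')) x =
      (k * a ^ m) • g (a • x, b • v') := by
    have := iteratedFDeriv_const_smul_apply' (a := k) (x := x)
      ((hx (b • v')).comp (contDiff_const_smul a)).contDiffAt
    simp only [Function.comp_def, smul_eq_mul] at this
    rw [this, iteratedFDeriv_comp_const_smul a (hx (b • v')), hg, smul_smul]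
  simp only [hin]
  have hout := iteratedFDeriv_const_smul_apply' (a := k * a ^ m) (x := v)
    (hv.comp (contDiff_const_smul b)).contDiffAt
  simp only [Function.comp_def] at hout
  rw [hout, iteratedFDeriv_comp_const_smul b hv, smul_smul]

end

/-- Weighted mixed-norm estimates for derivatives of `∂_t(Γ_t g_t)`:
`‖ |x|^α |v|^β |∇_x^m ∇_v^n ∂_t(Γ_t g_t)| ‖_𝐩
   ≤ C t^{(3(α-m)+(β-n)-2)/2 - 𝐚·(d/2)(1-1/𝐩)}`. -/
theorem ptShearKer_weighted_deriv_mixedNorm_bound (d : ℕ) (α β : ℝ)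
    (hα : 0 ≤ α) (hβ : 0 ≤ β) (m n : ℕ) (px pv : ℝ≥0∞) (hpx : 1 ≤ px) (hpv : 1 ≤ pv) :
    ∃ C : ℝ, 0 < C ∧ ∀ t : ℝ, 0 < t → t ≤ 1 →
      mixedNorm px pv
          (fun z => ‖z.1‖ ^ α * ‖z.2‖ ^ β *
            ‖iteratedFDeriv ℝ n
              (fun v' => iteratedFDeriv ℝ m (fun x' => ptShearKer d t (x', v')) z.1) z.2‖)
        ≤ ENNReal.ofReal (C * t ^ ((3 * (α - m) + (β - n) - 2) / 2
            - ((3 * (d : ℝ) / 2) * (1 - (px⁻¹).toReal)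
              + ((d : ℝ) / 2) * (1 - (pv⁻¹).toReal)))) := by
  obtain ⟨G, hG⟩ := exists_schwartzMap_ptShearKer_one d
  obtain ⟨g, h, hg, hh⟩ := G.exists_iteratedFDeriv_iteratedFDeriv m n
  have hvol : (volume : Measure (EuclideanSpace ℝ (Fin d))).HasTemperateGrowth := inferInstance
  obtain ⟨k, hk⟩ := hvol.exists_eLpNorm_lt_top px
  obtain ⟨l, hl⟩ := hvol.exists_eLpNorm_lt_top pv
  obtain ⟨K, hK, hbound⟩ := h.exists_weighted_le hα hβ k l
  set Nx := (eLpNorm (fun x : EuclideanSpace ℝ (Fin d) => (1 + ‖x‖) ^ (-k : ℝ)) px volume).toReal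
  set Nv := (eLpNorm (fun x : EuclideanSpace ℝ (Fin d) => (1 + ‖x‖) ^ (-l : ℝ)) pv volume).toReal
  have hN : 0 ≤ K * Nx * Nv := by positivity
  refine ⟨K * Nx * Nv + 1, by positivity, fun t ht _ => ?_⟩
  set a := t ^ (-3 / 2 : ℝ) with ha_def
  set b := t ^ (-1 / 2 : ℝ) with hb_def
  have ha : 0 < a := by positivity
  have hb : 0 < b := by positivity
  set s := t ^ (-2 * (d : ℝ) - 1) with hs_def
  have hs : 0 < s := by positivity
  have hpt : ∀ x v : EuclideanSpace ℝ (Fin d), ptShearKer d t (x, v) = s * G (a • x, b • v) :=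
    fun x v => by rw [hG, ptShearKer_scaling d ht]
  have hnorm {c γ : ℝ} (hc : 0 < c) (x : EuclideanSpace ℝ (Fin d)) :
      ‖x‖ ^ γ = c ^ (-γ) * ‖c • x‖ ^ γ := by
    rw [norm_smul, Real.norm_of_nonneg hc.le, Real.mul_rpow hc.le (norm_nonneg x), ← mul_assoc,
      ← Real.rpow_add hc, neg_add_cancel, Real.rpow_zero, one_mul]
  refine (mixedNorm_le_of_le_mul_s8 hk hl
    (A := K * (s * a ^ m * b ^ n * a ^ (-α) * b ^ (-β))) (by positivity) ha hb
    fun x v => ?_).trans (ENNReal.ofReal_le_ofReal ?_)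
  · simp only [hpt]
    rw [SchwartzMap.iteratedFDeriv_iteratedFDeriv_dilation hg, ← hh, norm_smul, hnorm ha x,
      hnorm hb v, Real.norm_of_nonneg (by positivity), Real.norm_of_nonneg (by positivity),
      Real.norm_of_nonneg (by positivity), Real.norm_of_nonneg (by positivity)]
    calc _ = s * a ^ m * b ^ n * a ^ (-α) * b ^ (-β) *
          (‖a • x‖ ^ α * ‖b • v‖ ^ β * ‖h (a • x, b • v)‖) := by ring
      _ ≤ s * a ^ m * b ^ n * a ^ (-α) * b ^ (-β) *
          (K * (1 + ‖a • x‖) ^ (-k : ℝ) * (1 + ‖b • v‖) ^ (-l : ℝ)) :=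
          mul_le_mul_of_nonneg_left (hbound _ _) (by positivity)
      _ = _ := by ring
  · have hpow : s * a ^ m * b ^ n * a ^ (-α) * b ^ (-β) * a ^ (-(d : ℝ) * (px⁻¹).toReal) *
        b ^ (-(d : ℝ) * (pv⁻¹).toReal) = t ^ ((3 * (α - m) + (β - n) - 2) / 2
            - ((3 * (d : ℝ) / 2) * (1 - (px⁻¹).toReal)
              + ((d : ℝ) / 2) * (1 - (pv⁻¹).toReal))) := by
      rw [← Real.rpow_natCast a, ← Real.rpow_natCast b, ha_def, hb_def, hs_def]
      simp only [← Real.rpow_mul ht.le, ← Real.rpow_add ht]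
      congr 1; ring
    rw [← hpow]
    calc _ = K * Nx * Nv * (s * a ^ m * b ^ n * a ^ (-α) * b ^ (-β) *
          a ^ (-(d : ℝ) * (px⁻¹).toReal) * b ^ (-(d : ℝ) * (pv⁻¹).toReal)) := by ring
      _ ≤ _ := by gcongr; simp
end
end
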